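/- arXiv:1711.02063 — 9 statements merged into one kernel-verified Lean document; each statement's English description precedes it below -/
import Mathlib

section
/- Fix Z > 0. For all positive reals x, y, the Hamiltonian of the two-particle affine relativistic Toda chain H(x,y) = √(x·y) + √(x/y) + 1/√(x·y) + Z·√(y/x) satisfies H(x', y') = H(x, y), where x' = y·(x+Z)²/(x+1)² and y' = 1/x. (Invariance of the relativistic Toda Hamiltonian under the discrete flow T of the A_7^{(1)'} cluster integrable system.) -/
/-- The Hamiltonian of the two-particle affine relativistic Toda chain
(the `A₇⁽¹⁾'` cluster integrable system), with Casimir parameter `Z`. -/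
noncomputable def hamToda (Z x y : ℝ) : ℝ :=
  Real.sqrt (x * y) + Real.sqrt (x / y) + 1 / Real.sqrt (x * y) + Z * Real.sqrt (y / x)

/-- On squares of positive reals the Hamiltonian is a rational function. -/
theorem hamToda_sq (Z : ℝ) {a b : ℝ} (ha : 0 < a) (hb : 0 < b) :
    hamToda Z (a ^ 2) (b ^ 2) = a * b + a / b + 1 / (a * b) + Z * (b / a) := by
  rw [hamToda, ← mul_pow, ← div_pow, ← div_pow, Real.sqrt_sq (by positivity),
    Real.sqrt_sq (by positivity), Real.sqrt_sq (by positivity)]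

/-- Invariance of the relativistic Toda Hamiltonian under the discrete flow `T`
of the `A₇⁽¹⁾'` cluster integrable system. -/
theorem hamToda_invariant (Z : ℝ) (hZ : 0 < Z) (x y : ℝ) (hx : 0 < x) (hy : 0 < y) :
    hamToda Z (y * (x + Z) ^ 2 / (x + 1) ^ 2) (1 / x) = hamToda Z x y := by
  obtain ⟨a, ha, rfl⟩ : ∃ a : ℝ, 0 < a ∧ a ^ 2 = x :=
    ⟨√x, Real.sqrt_pos.2 hx, Real.sq_sqrt hx.le⟩
  obtain ⟨b, hb, rfl⟩ : ∃ b : ℝ, 0 < b ∧ b ^ 2 = y :=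
    ⟨√y, Real.sqrt_pos.2 hy, Real.sq_sqrt hy.le⟩
  have hx' : b ^ 2 * (a ^ 2 + Z) ^ 2 / (a ^ 2 + 1) ^ 2
      = (b * (a ^ 2 + Z) / (a ^ 2 + 1)) ^ 2 := by
    rw [div_pow, mul_pow]
  rw [hx', ← one_div_pow, hamToda_sq Z (by positivity) (by positivity), hamToda_sq Z ha hb]
  field_simp
  ring
end

section
/- Fix Z > 0. For all positive reals x, y, the function H(x,y) = √(x·y) + √(x/y) + 1/√(x·y) + 1/(Z·x) satisfies H(x', y') = H(x, y), where x' = (1+x)/(Z·√(x³·y)) and y' = Z·√(x/y)·(1+x). (Invariance of the Hamiltonian of the A_7^{(1)} cluster integrable system, a second affinization of the two-particle relativistic Toda chain, under its discrete flow T.) -/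
/-- The Hamiltonian of the `A₇⁽¹⁾` cluster integrable system (a second affinization
of the two-particle relativistic Toda chain), with Casimir parameter `Z`. -/
noncomputable def hamA7 (Z x y : ℝ) : ℝ :=
  Real.sqrt (x * y) + Real.sqrt (x / y) + 1 / Real.sqrt (x * y) + 1 / (Z * x)

/-- Invariance of the `A₇⁽¹⁾` Hamiltonian under the discrete flow `T`. -/
theorem hamA7_invariant (Z : ℝ) (hZ : 0 < Z) (x y : ℝ) (hx : 0 < x) (hy : 0 < y) :
    hamA7 Z ((1 + x) / (Z * Real.sqrt (x ^ 3 * y))) (Z * Real.sqrt (x / y) * (1 + x))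
      = hamA7 Z x y := by
  obtain ⟨s, hs, rfl⟩ : ∃ s : ℝ, 0 < s ∧ s ^ 2 = x :=
    ⟨Real.sqrt x, Real.sqrt_pos.2 hx, Real.sq_sqrt hx.le⟩
  obtain ⟨t, ht, rfl⟩ : ∃ t : ℝ, 0 < t ∧ t ^ 2 = y :=
    ⟨Real.sqrt y, Real.sqrt_pos.2 hy, Real.sq_sqrt hy.le⟩
  have hcube : Real.sqrt ((s ^ 2) ^ 3 * t ^ 2) = s ^ 3 * t := by
    rw [show (s ^ 2) ^ 3 * t ^ 2 = (s ^ 3 * t) ^ 2 by ring]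
    exact Real.sqrt_sq (by positivity)
  have hdiv : Real.sqrt (s ^ 2 / t ^ 2) = s / t := by
    rw [← div_pow]
    exact Real.sqrt_sq (by positivity)
  have hmul : Real.sqrt (s ^ 2 * t ^ 2) = s * t := by
    rw [← mul_pow]
    exact Real.sqrt_sq (by positivity)
  have hmul' : Real.sqrt ((1 + s ^ 2) / (Z * (s ^ 3 * t)) * (Z * (s / t) * (1 + s ^ 2)))
      = (1 + s ^ 2) / (s * t) := by
    rw [show (1 + s ^ 2) / (Z * (s ^ 3 * t)) * (Z * (s / t) * (1 + s ^ 2))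
      = ((1 + s ^ 2) / (s * t)) ^ 2 by field_simp]
    exact Real.sqrt_sq (by positivity)
  have hdiv' : Real.sqrt ((1 + s ^ 2) / (Z * (s ^ 3 * t)) / (Z * (s / t) * (1 + s ^ 2)))
      = 1 / (Z * s ^ 2) := by
    rw [show (1 + s ^ 2) / (Z * (s ^ 3 * t)) / (Z * (s / t) * (1 + s ^ 2))
      = (1 / (Z * s ^ 2)) ^ 2 by field_simp]
    exact Real.sqrt_sq (by positivity)
  unfold hamA7
  rw [hcube, hdiv, hmul', hdiv', hmul]
  field_simp
  ring
end

section
/- Let y₁, y₂, y₃, y₄ > 0 and let T act by (y₁,y₂,y₃,y₄) ↦ (y₂(y₃+1)²/(y₁⁻¹+1)², y₁⁻¹, y₄(y₁+1)²/(y₃⁻¹+1)², y₃⁻¹). Then the transformed quantities satisfy q' = q, Z' = q·Z, F' = (F+qZ)²/((F+1)²·G), and G' = F. (The cluster transformation T = (1,2)(3,4)∘μ₁∘μ₃ of the A_7^{(1)'} quiver realizes the q-Painlevé flow of surface type A_7^{(1)'}.) -/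
/-- `q = y₁y₂y₃y₄` for the `A₇⁽¹⁾'` quiver. -/
def qA7' (y₁ y₂ y₃ y₄ : ℝ) : ℝ := y₁ * y₂ * y₃ * y₄

/-- `Z = 1/(y₂y₄)` for the `A₇⁽¹⁾'` quiver. -/
noncomputable def ZA7' (_y₁ y₂ _y₃ y₄ : ℝ) : ℝ := 1 / (y₂ * y₄)

/-- `F = y₁` for the `A₇⁽¹⁾'` quiver. -/
def FA7' (y₁ _y₂ _y₃ _y₄ : ℝ) : ℝ := y₁

/-- `G = 1/y₂` for the `A₇⁽¹⁾'` quiver. -/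
noncomputable def GA7' (_y₁ y₂ _y₃ _y₄ : ℝ) : ℝ := 1 / y₂

/-- The cluster transformation `T = (1,2)(3,4)∘μ₁∘μ₃` of the `A₇⁽¹⁾'` quiver realizes the
`q`-Painlevé flow of surface type `A₇⁽¹⁾'`:
`q' = q`, `Z' = qZ`, `F' = (F+qZ)²/((F+1)²G)`, `G' = F`. -/
theorem A7'_T_is_qPainleve (y₁ y₂ y₃ y₄ : ℝ)
    (h₁ : 0 < y₁) (h₂ : 0 < y₂) (h₃ : 0 < y₃) (h₄ : 0 < y₄) :
    qA7' (y₂ * (y₃ + 1) ^ 2 / (y₁⁻¹ + 1) ^ 2) y₁⁻¹ (y₄ * (y₁ + 1) ^ 2 / (y₃⁻¹ + 1) ^ 2) y₃⁻¹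
        = qA7' y₁ y₂ y₃ y₄ ∧
      ZA7' (y₂ * (y₃ + 1) ^ 2 / (y₁⁻¹ + 1) ^ 2) y₁⁻¹ (y₄ * (y₁ + 1) ^ 2 / (y₃⁻¹ + 1) ^ 2) y₃⁻¹
        = qA7' y₁ y₂ y₃ y₄ * ZA7' y₁ y₂ y₃ y₄ ∧
      FA7' (y₂ * (y₃ + 1) ^ 2 / (y₁⁻¹ + 1) ^ 2) y₁⁻¹ (y₄ * (y₁ + 1) ^ 2 / (y₃⁻¹ + 1) ^ 2) y₃⁻¹
        = (FA7' y₁ y₂ y₃ y₄ + qA7' y₁ y₂ y₃ y₄ * ZA7' y₁ y₂ y₃ y₄) ^ 2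
            / ((FA7' y₁ y₂ y₃ y₄ + 1) ^ 2 * GA7' y₁ y₂ y₃ y₄) ∧
      GA7' (y₂ * (y₃ + 1) ^ 2 / (y₁⁻¹ + 1) ^ 2) y₁⁻¹ (y₄ * (y₁ + 1) ^ 2 / (y₃⁻¹ + 1) ^ 2) y₃⁻¹
        = FA7' y₁ y₂ y₃ y₄ := by
  have e₁ : y₁⁻¹ + 1 = (y₁ + 1) / y₁ := by field_simp; ring
  have e₃ : y₃⁻¹ + 1 = (y₃ + 1) / y₃ := by field_simp; ring
  have n₁ : y₁ + 1 ≠ 0 := by positivity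
  have n₃ : y₃ + 1 ≠ 0 := by positivity
  simp only [qA7', ZA7', FA7', GA7', e₁, e₃]
  refine ⟨?_, ?_, ?_, ?_⟩
  · field_simp
  · field_simp
  · field_simp
    ring
  · field_simp
end

section
/- Consider the self-maps of (ℝ_{>0})⁴ with coordinates (Z,q,F,G): T(Z,q,F,G) = (qZ, q, (F+qZ)²/((F+1)²G), F), π₂(Z,q,F,G) = (1/(qZ), q, G/Z, 1/F), and π₁(Z,q,F,G) = (1/Z, 1/q, F/(qZ), 1/G). Then: π₁∘π₁ = id, π₂∘π₂∘π₂∘π₂ = id, (π₁∘π₂)∘(π₁∘π₂) = id, (π₂∘T)∘(π₂∘T) = id, and (T∘π₂)∘(T∘π₂) = id. (Hence s₀ = π₂T and s₁ = Tπ₂ are involutions, generating the affine Weyl group W(A_1^{(1)}) inside the symmetry group of the q-Painlevé equation of surface type A_7^{(1)'}.) -/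
/-- The flow `T` of the `q`-Painlevé system of surface type `A₇⁽¹⁾'` acting on `(Z,q,F,G)`. -/
noncomputable def TmapA7' : ℝ × ℝ × ℝ × ℝ → ℝ × ℝ × ℝ × ℝ :=
  fun p => match p with
  | (Z, q, F, G) => (q * Z, q, (F + q * Z) ^ 2 / ((F + 1) ^ 2 * G), F)

/-- The symmetry `π₂` of the `q`-Painlevé system of surface type `A₇⁽¹⁾'`. -/
noncomputable def pi2A7' : ℝ × ℝ × ℝ × ℝ → ℝ × ℝ × ℝ × ℝ :=
  fun p => match p with
  | (Z, q, F, G) => (1 / (q * Z), q, G / Z, 1 / F)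

/-- The symmetry `π₁` of the `q`-Painlevé system of surface type `A₇⁽¹⁾'`. -/
noncomputable def pi1A7' : ℝ × ℝ × ℝ × ℝ → ℝ × ℝ × ℝ × ℝ :=
  fun p => match p with
  | (Z, q, F, G) => (1 / Z, 1 / q, F / (q * Z), 1 / G)

/-- Relations in the symmetry group of the `q`-Painlevé equation of surface type `A₇⁽¹⁾'`:
`π₁² = π₂⁴ = (π₁π₂)² = (π₂T)² = (Tπ₂)² = id` on positive quadruples; hence
`s₀ = π₂T` and `s₁ = Tπ₂` are involutions generating `W(A₁⁽¹⁾)`. -/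
theorem A7'_symmetry_group_relations (Z q F G : ℝ)
    (hZ : 0 < Z) (hq : 0 < q) (hF : 0 < F) (hG : 0 < G) :
    pi1A7' (pi1A7' (Z, q, F, G)) = (Z, q, F, G) ∧
      pi2A7' (pi2A7' (pi2A7' (pi2A7' (Z, q, F, G)))) = (Z, q, F, G) ∧
      (pi1A7' ∘ pi2A7') ((pi1A7' ∘ pi2A7') (Z, q, F, G)) = (Z, q, F, G) ∧
      (pi2A7' ∘ TmapA7') ((pi2A7' ∘ TmapA7') (Z, q, F, G)) = (Z, q, F, G) ∧
      (TmapA7' ∘ pi2A7') ((TmapA7' ∘ pi2A7') (Z, q, F, G)) = (Z, q, F, G) := by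
  simp only [Function.comp_apply, TmapA7', pi1A7', pi2A7', Prod.mk.injEq, true_and]
  refine ⟨⟨?_, ?_, ?_, ?_⟩, ⟨?_, ?_, ?_⟩, ⟨?_, ?_, ?_, ?_⟩, ⟨?_, ?_, ?_⟩,
    ⟨?_, ?_, ?_⟩⟩ <;> field_simp
end

section
/- Fix q > 0 and let F, G : ℝ_{>0} → ℝ_{>0} satisfy, for all Z > 0: F(qZ)·F(Z) = Z·(1+G(Z)) and G(qZ)·F(Z)·G(Z) = Z·(1+G(Z)). Then for all Z > 0: G(qZ)·G(Z)²·G(q⁻¹Z) = Z·(G(Z)+1). (Iteration of the flow T of the A_7^{(1)} cluster system yields the q-Painlevé equation of surface type A_7^{(1)}.) -/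
/-- Iteration of the flow `T` of the `A₇⁽¹⁾` cluster system yields the `q`-Painlevé
equation of surface type `A₇⁽¹⁾`: `G(qZ)G(Z)²G(q⁻¹Z) = Z(G(Z)+1)`. -/
theorem qPainleve_A7 (q : ℝ) (hq : 0 < q) (F G : ℝ → ℝ)
    (hFpos : ∀ Z : ℝ, 0 < Z → 0 < F Z) (hGpos : ∀ Z : ℝ, 0 < Z → 0 < G Z)
    (hF : ∀ Z : ℝ, 0 < Z → F (q * Z) * F Z = Z * (1 + G Z))
    (hG : ∀ Z : ℝ, 0 < Z → G (q * Z) * F Z * G Z = Z * (1 + G Z)) :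
    ∀ Z : ℝ, 0 < Z → G (q * Z) * (G Z) ^ 2 * G (q⁻¹ * Z) = Z * (G Z + 1) := by
  intro Z hZ
  have hW : 0 < q⁻¹ * Z := by positivity
  have hqW : q * (q⁻¹ * Z) = Z := mul_inv_cancel_left₀ hq.ne' Z
  have hF' := hF _ hW
  have hG' := hG _ hW
  rw [hqW] at hF' hG'
  have hFZ : F Z = G Z * G (q⁻¹ * Z) := by
    apply mul_right_cancel₀ (hFpos _ hW).ne'
    linear_combination hF' - hG'
  have hGZ := hG Z hZ
  rw [hFZ] at hGZ
  linear_combination hGZ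
end

section
/- Let R be an associative unital ring, ρ ∈ R a central unit, p := ρ², and u₁, u₂, u₃, u₄ ∈ R units satisfying u₁u₂ = ρ⁻²u₂u₁, u₂u₃ = ρ⁻²u₃u₂, u₃u₄ = ρ⁻²u₄u₃, u₄u₁ = ρ⁻²u₁u₄, u₁u₃ = u₃u₁, u₂u₄ = u₄u₂, and such that 1+p·u₁⁻² and 1+p·u₃⁻² are invertible. Define u₁' = u₂(1+p·u₃²)(1+p·u₁⁻²)⁻¹, u₂' = u₁⁻¹, u₃' = u₄(1+p·u₁²)(1+p·u₃⁻²)⁻¹, u₄' = u₃⁻¹. Then (u₁')²(u₃')² = u₁⁴u₃⁴u₂²u₄² and (u₁')²(u₃')²(u₂')²(u₄')² = u₁²u₃²u₂²u₄²; that is, writing y_i = u_i², Z = y₁y₃, q = y₁y₃y₂y₄, the quantum discrete flow T sends (q, Z) to (q, qZ). -/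
/-- If `u` and `v` commute up to opposite central factors with `w`, their product commutes
with `w`. -/
theorem commute_mul_of_twisted {R : Type*} [Ring R] {p u v w : R} (hp : ∀ x, Commute p x)
    (h₁ : p * (u * w) = w * u) (h₂ : p * (w * v) = v * w) : Commute (u * v) w := by
  calc u * v * w = u * (p * (w * v)) := by rw [h₂, mul_assoc]
    _ = p * (u * w) * v := by rw [← mul_assoc u p, ← (hp u).eq]; simp only [mul_assoc]
    _ = w * (u * v) := by rw [h₁, mul_assoc]

/-- Moving `u ^ 2` past `w` picks up the square of the central factor. -/
theorem sq_mul_of_twisted {R : Type*} [Ring R] {p u w : R} (hp : ∀ x, Commute p x)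
    (h : p * (w * u) = u * w) : p * (p * (w * u ^ 2)) = u ^ 2 * w := by
  calc p * (p * (w * u ^ 2)) = p * (p * (w * u) * u) := by simp only [sq, mul_assoc]
    _ = p * u * (w * u) := by rw [h]; simp only [mul_assoc]
    _ = u * (p * (w * u)) := by rw [(hp u).eq, mul_assoc]
    _ = u ^ 2 * w := by rw [h, sq, mul_assoc]

theorem one_add_mul_inv_sq_mul_of_twisted {R : Type*} [Ring R] {p w : R} {u : Rˣ}
    (hp : ∀ x, Commute p x) (h : p * (w * u) = u * w) :
    (1 + p * ((u⁻¹ : Rˣ) : R) ^ 2) * (w * (p * (u : R) ^ 2)) = w * (1 + p * (u : R) ^ 2) := by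
  have hs := sq_mul_of_twisted hp h
  have hi : ((u⁻¹ : Rˣ) : R) ^ 2 * (u : R) ^ 2 = 1 := by
    rw [← Units.val_pow_eq_pow_val, ← Units.val_pow_eq_pow_val, inv_pow, Units.inv_mul]
  have : p * ((u⁻¹ : Rˣ) : R) ^ 2 * (w * (p * (u : R) ^ 2)) = w := by
    calc p * ((u⁻¹ : Rˣ) : R) ^ 2 * (w * (p * (u : R) ^ 2))
        = ((u⁻¹ : Rˣ) : R) ^ 2 * (p * (p * (w * (u : R) ^ 2))) := by
          rw [(hp _).eq, mul_assoc, ← mul_assoc w p, ← (hp w).eq, mul_assoc p w]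
      _ = w := by rw [hs, ← mul_assoc, hi, one_mul]
  rw [add_mul, one_mul, this, mul_add, mul_one, add_comm]

theorem one_add_mul_sq_mul_of_twisted {R : Type*} [Ring R] {p w : R} {u : Rˣ}
    (hp : ∀ x, Commute p x) (h : p * (u * w) = w * u) :
    (1 + p * (u : R) ^ 2) * (w * p) = w * (u : R) ^ 2 * (1 + p * ((u⁻¹ : Rˣ) : R) ^ 2) := by
  have hi : (u : R) ^ 2 * ((u⁻¹ : Rˣ) : R) ^ 2 = 1 := by
    rw [← Units.val_pow_eq_pow_val, ← Units.val_pow_eq_pow_val, inv_pow, Units.mul_inv]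
  have hs : p * (p * ((u : R) ^ 2 * w)) = w * (u : R) ^ 2 := by
    calc p * (p * ((u : R) ^ 2 * w)) = p * (p * u * (u * w)) := by simp only [sq, mul_assoc]
      _ = p * (u * (p * (u * w))) := by rw [(hp u).eq, mul_assoc]
      _ = p * (u * (w * u)) := by rw [h]
      _ = p * (u * w) * u := by simp only [mul_assoc]
      _ = w * (u : R) ^ 2 := by rw [h, sq, mul_assoc]
  have h₁ : p * (u : R) ^ 2 * (w * p) = w * (u : R) ^ 2 := by
    rw [← (hp w).eq, mul_assoc, ← mul_assoc _ p w, ← (hp _).eq, mul_assoc p, hs]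
  have h₂ : w * (u : R) ^ 2 * (p * ((u⁻¹ : Rˣ) : R) ^ 2) = w * p := by
    rw [mul_assoc, ← mul_assoc _ p, ← (hp _).eq, mul_assoc p, hi, mul_one]
  rw [add_mul, one_mul, h₁, mul_add, mul_one, h₂, add_comm]

/-- The quantum discrete flow `T` of the deautonomized quantum relativistic Toda chain
(quiver `A₇⁽¹⁾'`) sends the Casimir pair `(q, Z)` to `(q, qZ)`: with `u_i = y_i^{1/2}`,
`Z = y₁y₃ = u₁²u₃²`, `q = y₁y₃y₂y₄ = u₁²u₃²u₂²u₄²`, we have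
`Z' = (u₁')²(u₃')² = u₁⁴u₃⁴u₂²u₄² = qZ` and `q' = (u₁')²(u₃')²(u₂')²(u₄')² = u₁²u₃²u₂²u₄² = q`. -/
theorem quantum_A7'_flow_on_casimirs {R : Type*} [Ring R] (ρ : Rˣ)
    (hρ : ∀ x : R, (ρ : R) * x = x * (ρ : R))
    (u₁ u₂ u₃ u₄ : Rˣ)
    (h12 : (u₁ : R) * u₂ = ((ρ⁻¹ : Rˣ) : R) ^ 2 * ((u₂ : R) * u₁))
    (h23 : (u₂ : R) * u₃ = ((ρ⁻¹ : Rˣ) : R) ^ 2 * ((u₃ : R) * u₂))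
    (h34 : (u₃ : R) * u₄ = ((ρ⁻¹ : Rˣ) : R) ^ 2 * ((u₄ : R) * u₃))
    (h41 : (u₄ : R) * u₁ = ((ρ⁻¹ : Rˣ) : R) ^ 2 * ((u₁ : R) * u₄))
    (h13 : (u₁ : R) * u₃ = (u₃ : R) * u₁) (h24 : (u₂ : R) * u₄ = (u₄ : R) * u₂)
    (hA : IsUnit (1 + (ρ : R) ^ 2 * ((u₁⁻¹ : Rˣ) : R) ^ 2))
    (hB : IsUnit (1 + (ρ : R) ^ 2 * ((u₃⁻¹ : Rˣ) : R) ^ 2)) :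
    ((u₂ : R) * (1 + (ρ : R) ^ 2 * (u₃ : R) ^ 2)
          * Ring.inverse (1 + (ρ : R) ^ 2 * ((u₁⁻¹ : Rˣ) : R) ^ 2)) ^ 2
        * ((u₄ : R) * (1 + (ρ : R) ^ 2 * (u₁ : R) ^ 2)
          * Ring.inverse (1 + (ρ : R) ^ 2 * ((u₃⁻¹ : Rˣ) : R) ^ 2)) ^ 2
      = (u₁ : R) ^ 4 * (u₃ : R) ^ 4 * (u₂ : R) ^ 2 * (u₄ : R) ^ 2 ∧
    ((u₂ : R) * (1 + (ρ : R) ^ 2 * (u₃ : R) ^ 2)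
          * Ring.inverse (1 + (ρ : R) ^ 2 * ((u₁⁻¹ : Rˣ) : R) ^ 2)) ^ 2
        * ((u₄ : R) * (1 + (ρ : R) ^ 2 * (u₁ : R) ^ 2)
          * Ring.inverse (1 + (ρ : R) ^ 2 * ((u₃⁻¹ : Rˣ) : R) ^ 2)) ^ 2
        * ((u₁⁻¹ : Rˣ) : R) ^ 2 * ((u₃⁻¹ : Rˣ) : R) ^ 2
      = (u₁ : R) ^ 2 * (u₃ : R) ^ 2 * (u₂ : R) ^ 2 * (u₄ : R) ^ 2 := by
  have hp : ∀ x, Commute ((ρ : R) ^ 2) x := fun x => (show Commute (ρ : R) x from hρ x).pow_left 2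
  have clear_inv : ∀ x y : R, x = ((ρ⁻¹ : Rˣ) : R) ^ 2 * y → (ρ : R) ^ 2 * x = y := by
    intro x y h
    rw [h, ← Units.val_pow_eq_pow_val, ← Units.val_pow_eq_pow_val, inv_pow, Units.mul_inv_cancel_left]
  replace h12 := clear_inv _ _ h12
  replace h23 := clear_inv _ _ h23
  replace h34 := clear_inv _ _ h34
  replace h41 := clear_inv _ _ h41
  clear clear_inv
  generalize (ρ : R) ^ 2 = p at *
  have c13 : Commute (u₁ : R) u₃ := h13
  have c24 : Commute (u₂ : R) u₄ := h24
  have c2 : Commute ((u₁ : R) * u₃) u₂ := commute_mul_of_twisted hp h12 h23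
  have c1 : Commute ((u₂ : R) * u₄) u₁ := by
    rw [c24.eq]; exact commute_mul_of_twisted hp h41 h12
  have c3 : Commute ((u₂ : R) * u₄) u₃ := commute_mul_of_twisted hp h23 h34
  have c : Commute ((u₂ : R) * u₄) (((u₁ : R) * u₃) ^ 2) := (c1.mul_right c3).pow_right 2
  obtain ⟨M, hM⟩ : ∃ M, M = (u₂ : R) * u₄ * ((u₁ : R) * u₃) ^ 2 := ⟨_, rfl⟩
  have m1 : Commute M u₁ := by
    rw [hM]; exact c1.mul_left (((Commute.refl _).mul_left c13.symm).pow_left 2)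
  have m3 : Commute M u₃ := by
    rw [hM]; exact c3.mul_left ((c13.mul_left (Commute.refl _)).pow_left 2)
  have m2 : Commute M u₂ := by
    rw [hM]; exact ((Commute.refl _).mul_left c24.symm).mul_left (c2.pow_left 2)
  have hMM : M * M = (u₁ : R) ^ 4 * (u₃ : R) ^ 4 * (u₂ : R) ^ 2 * (u₄ : R) ^ 2 := by
    rw [← sq, hM, c.mul_pow, (c.pow_pow 2 2).eq, ← pow_mul, c13.mul_pow, c24.mul_pow]
    simp only [mul_assoc]
  have mA : Commute M (1 + p * ((u₁⁻¹ : Rˣ) : R) ^ 2) :=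
    (Commute.one_right _).add_right ((hp M).symm.mul_right (m1.units_inv_right.pow_right 2))
  have mD : Commute M (1 + p * (u₃ : R) ^ 2) :=
    (Commute.one_right _).add_right ((hp M).symm.mul_right (m3.pow_right 2))
  have cB : Commute (1 + p * ((u₃⁻¹ : Rˣ) : R) ^ 2) ((u₁ : R) ^ 2) :=
    (Commute.one_left _).add_left
      ((hp _).mul_left (c13.units_inv_right.symm.pow_pow 2 2))
  have kA := one_add_mul_inv_sq_mul_of_twisted hp h41
  have kD := one_add_mul_sq_mul_of_twisted hp h34
  obtain ⟨a, ha⟩ := hA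
  obtain ⟨b, hb⟩ := hB
  rw [← ha] at mA kA ⊢
  rw [← hb] at cB kD ⊢
  rw [Ring.inverse_unit, Ring.inverse_unit]
  generalize 1 + p * (u₃ : R) ^ 2 = D at *
  generalize 1 + p * (u₁ : R) ^ 2 = C at *
  have hXY : (u₂ : R) * D * ((a⁻¹ : Rˣ) : R) * (u₄ * C * ((b⁻¹ : Rˣ) : R)) = M := by
    calc (u₂ : R) * D * ((a⁻¹ : Rˣ) : R) * (u₄ * C * ((b⁻¹ : Rˣ) : R))
        = u₂ * (D * (u₄ * p)) * (u₁ : R) ^ 2 * ((b⁻¹ : Rˣ) : R) := by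
          rw [← kA]; simp only [mul_assoc, Units.inv_mul_cancel_left]
      _ = u₂ * u₄ * (u₃ : R) ^ 2 * (b * (u₁ : R) ^ 2) * ((b⁻¹ : Rˣ) : R) := by
          rw [kD]; simp only [mul_assoc]
      _ = u₂ * u₄ * ((u₃ : R) ^ 2 * (u₁ : R) ^ 2) := by
          rw [cB.eq]; simp only [mul_assoc, Units.mul_inv, mul_one]
      _ = M := by rw [hM, c13.mul_pow, (c13.pow_pow 2 2).eq]
  have mX : Commute M ((u₂ : R) * D * ((a⁻¹ : Rˣ) : R)) :=
    (m2.mul_right mD).mul_right mA.units_inv_right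
  generalize (u₂ : R) * D * ((a⁻¹ : Rˣ) : R) = X at *
  generalize (u₄ : R) * C * ((b⁻¹ : Rˣ) : R) = Y at *
  have hsq : X ^ 2 * Y ^ 2 = M * M := by
    calc X ^ 2 * Y ^ 2 = X * (X * Y) * Y := by simp only [sq, mul_assoc]
      _ = M * M := by rw [hXY, ← mX.eq, mul_assoc, hXY]
  refine ⟨hsq.trans hMM, ?_⟩
  have hN : M * ((u₁⁻¹ : Rˣ) : R) ^ 2 * ((u₃⁻¹ : Rˣ) : R) ^ 2 = u₂ * u₄ := by
    rw [hM, c13.mul_pow, (c13.pow_pow 2 2).eq]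
    simp only [← Units.val_pow_eq_pow_val, ← Units.val_mul, inv_pow]
    congr 1
    group
  calc X ^ 2 * Y ^ 2 * ((u₁⁻¹ : Rˣ) : R) ^ 2 * ((u₃⁻¹ : Rˣ) : R) ^ 2
      = M * (M * ((u₁⁻¹ : Rˣ) : R) ^ 2 * ((u₃⁻¹ : Rˣ) : R) ^ 2) := by
        rw [hsq]; simp only [mul_assoc]
    _ = ((u₁ : R) * u₃) ^ 2 * ((u₂ : R) * u₄) ^ 2 := by
        rw [hN, hM, c.eq, mul_assoc, ← sq]
    _ = (u₁ : R) ^ 2 * (u₃ : R) ^ 2 * (u₂ : R) ^ 2 * (u₄ : R) ^ 2 := by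
        rw [c13.mul_pow, c24.mul_pow]; simp only [mul_assoc]
end

section
/- Let R be an associative unital ring, r ∈ R a central unit, and τ₁,…,τ₆ ∈ R units satisfying τ_I τ_J = r^{Λ_{IJ}} τ_J τ_I, where Λ is the antisymmetric integer 6×6 matrix with (for I<J) Λ₁₄ = Λ₁₅ = Λ₂₅ = Λ₃₅ = Λ₄₅ = 1, Λ₂₃ = Λ₂₆ = Λ₄₆ = −1, and all other Λ_{IJ} = 0. Define G := r²τ₆²τ₁²τ₃⁻² and Ḡ := r²τ₅²τ₆²τ₂²τ₄⁻². Then Ḡ·G = r⁸·G·Ḡ. (With p = r², this is the quantum commutation relation Ḡ G = p⁴ G Ḡ between the quantum Painlevé transcendent G = pZ^{1/2}𝒯₁²𝒯₃⁻² and its time-translate Ḡ = p(qZ)^{1/2}𝒯₂²𝒯₄⁻².) -/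
/-- The compatible antisymmetric matrix `Λ` of the quantum `A`-cluster algebra of the
`A₇⁽¹⁾'` quiver (indices `0,…,5` correspond to `τ₁,…,τ₆`). -/
def LamA7' : Matrix (Fin 6) (Fin 6) ℤ :=
  !![0, 0, 0, 1, 1, 0;
     0, 0, -1, 0, 1, -1;
     0, 1, 0, 0, 1, 0;
     -1, 0, 0, 0, 1, -1;
     -1, -1, -1, -1, 0, 0;
     0, 1, 0, 1, 0, 0]

/-- Two elements `x`, `y` of a group commute up to the factor `r ^ n`. -/
def QCommute {H : Type*} [Group H] (r : H) (n : ℤ) (x y : H) : Prop :=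
  x * y = r ^ n * (y * x)

namespace QCommute

variable {H : Type*} [Group H] {r : H} {m n : ℤ} {x y z : H}

theorem symm (h : QCommute r n x y) : QCommute r (-n) y x := by
  unfold QCommute at *
  rw [h, ← mul_assoc, ← zpow_add, neg_add_cancel, zpow_zero, one_mul]

theorem mul_left (hr : ∀ x, Commute r x) (hx : QCommute r m x z) (hy : QCommute r n y z) :
    QCommute r (m + n) (x * y) z := by
  unfold QCommute at *
  calc x * y * z = x * r ^ n * (z * y) := by rw [mul_assoc, hy, mul_assoc]
    _ = r ^ n * (x * z) * y := by
      rw [← ((hr x).zpow_left n).eq]; simp only [mul_assoc]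
    _ = r ^ (m + n) * (z * (x * y)) := by
      rw [hx, add_comm m n, zpow_add]; simp only [mul_assoc]

theorem mul_right (hr : ∀ x, Commute r x) (hy : QCommute r m x y) (hz : QCommute r n x z) :
    QCommute r (m + n) x (y * z) := by
  have h := (mul_left hr hy.symm hz.symm).symm
  rwa [show -(-m + -n) = m + n by ring] at h

theorem inv_left (hr : ∀ x, Commute r x) (h : QCommute r n x y) : QCommute r (-n) x⁻¹ y := by
  unfold QCommute at *
  have hc := ((hr x).zpow_left n).eq
  have h' : y * x = r ^ (-n) * (x * y) := by rw [h, zpow_neg, inv_mul_cancel_left]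
  have hc' := ((hr x⁻¹).zpow_left (-n)).eq
  calc x⁻¹ * y = x⁻¹ * (y * x) * x⁻¹ := by group
    _ = r ^ (-n) * (y * x⁻¹) := by
      rw [h', ← mul_assoc x⁻¹, ← hc']; simp only [mul_assoc, inv_mul_cancel_left]

theorem inv_right (hr : ∀ x, Commute r x) (h : QCommute r n x y) : QCommute r (-n) x y⁻¹ := by
  simpa using (h.symm.inv_left hr).symm

theorem sq_left (hr : ∀ x, Commute r x) (h : QCommute r n x y) :
    QCommute r (n + n) (x ^ 2) y :=
  sq x ▸ h.mul_left hr h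

theorem sq_right (hr : ∀ x, Commute r x) (h : QCommute r n x y) :
    QCommute r (n + n) x (y ^ 2) :=
  sq y ▸ h.mul_right hr h

theorem base_left (hr : ∀ x, Commute r x) (x : H) : QCommute r 0 r x := by
  simpa [QCommute] using (hr x).eq

theorem base_right (hr : ∀ x, Commute r x) (x : H) : QCommute r 0 x r := by
  simpa [QCommute] using (hr x).symm.eq

end QCommute

/-- The quantum commutation relation `Ḡ G = p⁴ G Ḡ` (with `p = r²`) between the quantum
Painlevé transcendent `G = r²τ₆²τ₁²τ₃⁻²` and its time-translate `Ḡ = r²τ₅²τ₆²τ₂²τ₄⁻²`. -/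
theorem quantum_G_Gbar_commutation {R : Type*} [Ring R] (r : Rˣ)
    (hr : ∀ x : R, (r : R) * x = x * (r : R)) (τ : Fin 6 → Rˣ)
    (hrel : ∀ I J : Fin 6, (τ I : R) * (τ J : R)
      = ((r ^ LamA7' I J : Rˣ) : R) * ((τ J : R) * (τ I : R))) :
    ((r : R) ^ 2 * (τ 4 : R) ^ 2 * (τ 5 : R) ^ 2 * (τ 1 : R) ^ 2 * (((τ 3)⁻¹ : Rˣ) : R) ^ 2)
        * ((r : R) ^ 2 * (τ 5 : R) ^ 2 * (τ 0 : R) ^ 2 * (((τ 2)⁻¹ : Rˣ) : R) ^ 2)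
      = (r : R) ^ 8 *
        (((r : R) ^ 2 * (τ 5 : R) ^ 2 * (τ 0 : R) ^ 2 * (((τ 2)⁻¹ : Rˣ) : R) ^ 2)
          * ((r : R) ^ 2 * (τ 4 : R) ^ 2 * (τ 5 : R) ^ 2 * (τ 1 : R) ^ 2
            * (((τ 3)⁻¹ : Rˣ) : R) ^ 2)) := by
  have hc : ∀ x : Rˣ, Commute r x := fun x => Units.ext (hr x)
  have h : ∀ I J, QCommute r (LamA7' I J) (τ I) (τ J) := fun I J =>
    Units.ext (by simpa using hrel I J)
  have hGx : ∀ x : Rˣ, ∀ a b c : ℤ, QCommute r a x (τ 5) → QCommute r b x (τ 0) →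
      QCommute r c x (τ 2) →
      QCommute r _ x (r ^ 2 * τ 5 ^ 2 * τ 0 ^ 2 * (τ 2)⁻¹ ^ 2) := fun x a b c h5 h0 h2 =>
    ((((QCommute.base_right hc x).sq_right hc).mul_right hc (h5.sq_right hc)).mul_right hc
      (h0.sq_right hc)).mul_right hc ((h2.inv_right hc).sq_right hc)
  have hτ := fun I => hGx (τ I) _ _ _ (h I 5) (h I 0) (h I 2)
  have key := (((((QCommute.base_left hc _).sq_left hc).mul_left hc ((hτ 4).sq_left hc)).mul_left hc
    ((hτ 5).sq_left hc)).mul_left hc ((hτ 1).sq_left hc)).mul_left hc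
    (((hτ 3).inv_left hc).sq_left hc)
  have key' : QCommute r 8 (r ^ 2 * τ 4 ^ 2 * τ 5 ^ 2 * τ 1 ^ 2 * (τ 3)⁻¹ ^ 2)
      (r ^ 2 * τ 5 ^ 2 * τ 0 ^ 2 * (τ 2)⁻¹ ^ 2) := by
    convert key using 1
    decide
  have hu := congrArg (Units.val) key'
  rw [show (8 : ℤ) = ((8 : ℕ) : ℤ) by norm_num, zpow_natCast] at hu
  simpa only [Units.val_mul, Units.val_pow_eq_pow_val] using hu
end

section
/- Let R be an associative unital ring, r ∈ R a central unit, and τ₁,…,τ₆ ∈ R units satisfying τ_I τ_J = r^{Λ_{IJ}} τ_J τ_I, where Λ is the antisymmetric integer 6×6 matrix with (for I<J) Λ₁₄ = Λ₁₅ = Λ₂₅ = Λ₃₅ = Λ₄₅ = 1, Λ₂₃ = Λ₂₆ = Λ₄₆ = −1, and all other Λ_{IJ} = 0; assume furthermore that τ₃² + r⁴τ₆²τ₁² is invertible. Define G := r²τ₆²τ₁²τ₃⁻², Ḡ^{1/2} := r·τ₅·τ₆·τ₂·τ₄⁻¹, and G̲^{1/2} := r·τ₅⁻¹·τ₆·(τ₁²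 + r⁴τ₆²τ₃²)·τ₂⁻¹·τ₄·(τ₃² + r⁴τ₆²τ₁²)⁻¹. Then G̲^{1/2}·Ḡ^{1/2}·(G + r²) = G + r⁶τ₆⁴. (With p = r² and Z = τ₆⁴, this is the quantum q-Painlevé equation G̲^{1/2}Ḡ^{1/2} = (G + p³Z)(G + p)⁻¹ of surface type A_7^{(1)'}, derived from the bilinear equations for the quantum tau-functions.) -/
/-- If `x` semiconjugates `r * y` to `z` with `r` central, it semiconjugates `r ^ 2 * y ^ 2`
to `z ^ 2`. -/
theorem SemiconjBy.central_mul_sq {R : Type*} [Ring R] {r x y z : R}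
    (hr : ∀ x : R, r * x = x * r) (h : SemiconjBy x (r * y) z) :
    SemiconjBy x (r ^ 2 * y ^ 2) (z ^ 2) := by
  have h2 := h.pow_right 2
  rwa [(show Commute r y from hr y).mul_pow] at h2

/-- The square-root form of the quantum `q`-Painlevé equation of surface type `A₇⁽¹⁾'`:
with `G = r²τ₆²τ₁²τ₃⁻²`, `Ḡ^{1/2} = rτ₅τ₆τ₂τ₄⁻¹`, and
`G̲^{1/2} = rτ₅⁻¹τ₆(τ₁² + r⁴τ₆²τ₃²)τ₂⁻¹τ₄(τ₃² + r⁴τ₆²τ₁²)⁻¹`, the bilinear equations for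
the quantum tau-functions imply `G̲^{1/2}·Ḡ^{1/2}·(G + r²) = G + r⁶τ₆⁴`
(i.e. `G̲^{1/2}Ḡ^{1/2} = (G + p³Z)(G + p)⁻¹` with `p = r²`, `Z = τ₆⁴`). -/
theorem quantum_qPainleve_sqrt_form {R : Type*} [Ring R] (r : Rˣ)
    (hr : ∀ x : R, (r : R) * x = x * (r : R)) (τ : Fin 6 → Rˣ)
    (hrel : ∀ I J : Fin 6, (τ I : R) * (τ J : R)
      = ((r ^ LamA7' I J : Rˣ) : R) * ((τ J : R) * (τ I : R)))
    (hinv : IsUnit ((τ 2 : R) ^ 2 + (r : R) ^ 4 * (τ 5 : R) ^ 2 * (τ 0 : R) ^ 2)) :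
    ((r : R) * (((τ 4)⁻¹ : Rˣ) : R) * (τ 5 : R)
        * ((τ 0 : R) ^ 2 + (r : R) ^ 4 * (τ 5 : R) ^ 2 * (τ 2 : R) ^ 2)
        * (((τ 1)⁻¹ : Rˣ) : R) * (τ 3 : R)
        * Ring.inverse ((τ 2 : R) ^ 2 + (r : R) ^ 4 * (τ 5 : R) ^ 2 * (τ 0 : R) ^ 2))
      * ((r : R) * (τ 4 : R) * (τ 5 : R) * (τ 1 : R) * (((τ 3)⁻¹ : Rˣ) : R))
      * ((r : R) ^ 2 * (τ 5 : R) ^ 2 * (τ 0 : R) ^ 2 * (((τ 2)⁻¹ : Rˣ) : R) ^ 2 + (r : R) ^ 2)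
    = (r : R) ^ 2 * (τ 5 : R) ^ 2 * (τ 0 : R) ^ 2 * (((τ 2)⁻¹ : Rˣ) : R) ^ 2
        + (r : R) ^ 6 * (τ 5 : R) ^ 4 := by
  have hs (n : ℕ) (x y : R) : x * ((r : R) ^ n * y) = (r : R) ^ n * (x * y) := by
    rw [← mul_assoc, ← ((show Commute (r : R) x from hr x).pow_left n).eq, mul_assoc]
  have hs1 (x y : R) : x * ((r : R) * y) = (r : R) * (x * y) := by
    simpa using hs 1 x y
  have hcomm (I J : Fin 6) (h : LamA7' I J = 0) : SemiconjBy (τ I : R) (τ J : R) (τ J : R) := by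
    have := hrel I J
    rw [h] at this
    simpa [SemiconjBy] using this
  have hq (I J : Fin 6) (h : LamA7' J I = 1) :
      SemiconjBy (τ I : R) ((r : R) * (τ J : R)) (τ J : R) := by
    have := hrel J I
    rw [h] at this
    rw [SemiconjBy, hs1, this, zpow_one]
  have ec := hq 4 2 rfl
  have ea := hq 4 0 rfl
  have ez := hcomm 4 5 rfl
  have bc := hq 1 2 rfl
  have bz := hq 1 5 rfl
  have ba := hcomm 1 0 rfl
  have da := hq 3 0 rfl
  have dz := hq 3 5 rfl
  have dc := hcomm 3 2 rfl
  have db := hcomm 3 1 rfl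
  have za := hcomm 5 0 rfl
  have zc := hcomm 5 2 rfl
  have ed := hq 4 3 rfl
  have eb := hq 4 1 rfl
  generalize τ 0 = a at *
  generalize τ 1 = b at *
  generalize τ 2 = c at *
  generalize τ 3 = d at *
  generalize τ 4 = e at *
  generalize τ 5 = z at *
  have hrc (x : R) : SemiconjBy x (r : R) (r : R) := (hr x).symm
  set X : R := (e : R) * z * b * ((d⁻¹ : Rˣ) : R) with hX
  have Xc : SemiconjBy X ((r : R) * (r * c)) c :=
    ((ec.mul_left ((hrc _).mul_right zc)).mul_left ((hrc _).mul_right bc)).mul_left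
      ((hrc _).mul_right ((hrc _).mul_right dc.units_inv_symm_left))
  have Xa : SemiconjBy X a a :=
    ((ea.mul_left ((hrc _).mul_right za)).mul_left ((hrc _).mul_right ba)).mul_left
      da.units_inv_symm_left
  have Xz : SemiconjBy X z z :=
    ((ez.mul_left (Commute.refl (z : R))).mul_left bz).mul_left dz.units_inv_symm_left
  have XD : SemiconjBy X ((r : R) ^ 4 * ((c : R) ^ 2 + (z : R) ^ 2 * (a : R) ^ 2))
      ((c : R) ^ 2 + (r : R) ^ 4 * (z : R) ^ 2 * (a : R) ^ 2) := by
    have h := (Xc.pow_right 2).add_right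
      ((((hrc X).pow_right 4).mul_right (Xz.pow_right 2)).mul_right (Xa.pow_right 2))
    convert h using 1
    rw [← mul_assoc, ← pow_two, ((show Commute (r : R) c from hr c).pow_left 2).mul_pow,
      ← pow_mul, mul_add, mul_assoc]
  have hN : SemiconjBy (e : R)
      ((r : R) ^ 2 * (a : R) ^ 2 + (r : R) ^ 4 * (z : R) ^ 2 * ((r : R) ^ 2 * (c : R) ^ 2))
      ((a : R) ^ 2 + (r : R) ^ 4 * (z : R) ^ 2 * (c : R) ^ 2) :=
    (ea.central_mul_sq hr).add_right
      ((((hrc _).pow_right 4).mul_right (ez.pow_right 2)).mul_right (ec.central_mul_sq hr))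
  have hY : ((b⁻¹ : Rˣ) : R) * (d * X) = e * z := by
    have h : (d : R) * (e * z * b) = b * (e * z) * d := by
      calc (d : R) * (e * z * b) = e * ((r : R) * d) * (z * b) := by
            rw [ed.eq]; noncomm_ring
        _ = e * (d * ((r : R) * (z * b))) := by rw [hs1, mul_assoc, hs1, hs1, mul_assoc]
        _ = e * (d * ((r : R) * (b * ((r : R) * z)))) := by rw [bz.eq]
        _ = e * ((r : R) * b) * (d * ((r : R) * z)) := by
            rw [hs1 (d : R), ← mul_assoc (d : R), db.eq]; noncomm_ring
        _ = b * (e * z) * d := by rw [eb.eq, dz.eq]; noncomm_ring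
    rw [hX, ← mul_assoc (d : R), h, mul_assoc (_ * _) (d : R), Units.mul_inv, mul_one,
      ← mul_assoc, Units.inv_mul, one_mul]
  obtain ⟨u, hu⟩ := hinv
  rw [← hu] at XD ⊢
  rw [Ring.inverse_unit]
  have hF : ((u⁻¹ : Rˣ) : R)
      * (X * ((r : R) ^ 4 * ((c : R) ^ 2 + (z : R) ^ 2 * (a : R) ^ 2))) = X := by
    rw [XD.eq, ← mul_assoc, Units.inv_mul, one_mul]
  have hcc : (c : R) ^ 2 * ((c⁻¹ : Rˣ) : R) ^ 2 = 1 := by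
    rw [← Units.val_pow_eq_pow_val, ← Units.val_pow_eq_pow_val, inv_pow, Units.mul_inv]
  have hG : (r : R) ^ 2 * (z : R) ^ 2 * (a : R) ^ 2 * ((c⁻¹ : Rˣ) : R) ^ 2 + (r : R) ^ 2
      = (r : R) ^ 2 * (((c : R) ^ 2 + (z : R) ^ 2 * (a : R) ^ 2) * ((c⁻¹ : Rˣ) : R) ^ 2) := by
    rw [add_mul, hcc]
    noncomm_ring
  have hcollect (P Q E C : R) :
      (r : R) * P * ((r : R) * Q) * ((r : R) ^ 2 * (E * C)) = P * (Q * ((r : R) ^ 4 * E)) * C := by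
    rw [hs 4 Q, hs 4 P, hs1, hs 2]
    noncomm_ring
  have hz : (z : R) * ((r : R) ^ 2 * (a : R) ^ 2
        + (r : R) ^ 4 * (z : R) ^ 2 * ((r : R) ^ 2 * (c : R) ^ 2)) * z
      = (r : R) ^ 2 * (z : R) ^ 2 * (a : R) ^ 2 + (r : R) ^ 6 * (z : R) ^ 4 * (c : R) ^ 2 := by
    have h : SemiconjBy (z : R) ((r : R) ^ 2 * (a : R) ^ 2
        + (r : R) ^ 4 * (z : R) ^ 2 * ((r : R) ^ 2 * (c : R) ^ 2)) _ :=
      (((hrc _).pow_right 2).mul_right (za.pow_right 2)).add_right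
        ((((hrc _).pow_right 4).mul_right ((Commute.refl (z : R)).pow_right 2)).mul_right
          (((hrc _).pow_right 2).mul_right (zc.pow_right 2)))
    rw [mul_assoc, ← h.eq, ← mul_assoc, ← pow_two, mul_add, hs 2, hs 2 (_ * _), mul_assoc (_ ^ 4),
      hs 2, hs 4]
    noncomm_ring
  calc _ = (r : R) * (((e⁻¹ : Rˣ) : R) * z
          * ((a : R) ^ 2 + (r : R) ^ 4 * (z : R) ^ 2 * (c : R) ^ 2)
          * ((b⁻¹ : Rˣ) : R) * d * ((u⁻¹ : Rˣ) : R)) * ((r : R) * X)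
        * ((r : R) ^ 2 * (((c : R) ^ 2 + (z : R) ^ 2 * (a : R) ^ 2) * ((c⁻¹ : Rˣ) : R) ^ 2)) := by
        rw [hG]; simp only [hX, mul_assoc]
    _ = ((e⁻¹ : Rˣ) : R) * z * ((a : R) ^ 2 + (r : R) ^ 4 * (z : R) ^ 2 * (c : R) ^ 2)
          * (((b⁻¹ : Rˣ) : R) * (d * (((u⁻¹ : Rˣ) : R) * (X * ((r : R) ^ 4
            * ((c : R) ^ 2 + (z : R) ^ 2 * (a : R) ^ 2)))))) * ((c⁻¹ : Rˣ) : R) ^ 2 := by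
        rw [hcollect]; simp only [mul_assoc]
    _ = ((e⁻¹ : Rˣ) : R) * z * (((a : R) ^ 2 + (r : R) ^ 4 * (z : R) ^ 2 * (c : R) ^ 2)
          * e) * z * ((c⁻¹ : Rˣ) : R) ^ 2 := by
        rw [hF, hY]; simp only [mul_assoc]
    _ = ((e⁻¹ : Rˣ) : R) * (z * e) * ((r : R) ^ 2 * (a : R) ^ 2
          + (r : R) ^ 4 * (z : R) ^ 2 * ((r : R) ^ 2 * (c : R) ^ 2)) * z
          * ((c⁻¹ : Rˣ) : R) ^ 2 := by
        rw [← hN.eq]; simp only [mul_assoc]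
    _ = _ := by
        rw [← ez.eq, ← mul_assoc, Units.inv_mul, one_mul, hz, add_mul,
          mul_assoc (_ * _) ((c : R) ^ 2), hcc, mul_one]
end

section
/- Let R be an associative unital ring, p ∈ R a central unit, and g, z, k, h ∈ R such that: z commutes with g and with k; k·g = p⁻²·g·k; the elements g + p and g + p³ are invertible; and k·h·(g + p) = g + p·z. Then k²·h²·(g + p)·(g + p³) = (g + p·z)·(g + p³·z). (From the square-root form G̲^{1/2}Ḡ^{1/2} = (G+pZ)(G+p)⁻¹ of the quantum q-Painlevé equation together with the commutation relation between G and G̲^{1/2}, the full quantum q-Painlevé equation G̲Ḡ = (G+pZ)(G+p³Z)(G+p)⁻¹(G+p³)⁻¹ of surface type A_7^{(1)'} follows.) -/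
/-- From the square-root form `G̲^{1/2}Ḡ^{1/2} = (G + pZ)(G + p)⁻¹` of the quantum
`q`-Painlevé equation (here `k = G̲^{1/2}`, `h = Ḡ^{1/2}`, `g = G`, `z = Z`), together with
the commutation relation `kg = p⁻²gk` and centrality of `z`, the full quantum
`q`-Painlevé equation `k²h²(g + p)(g + p³) = (g + pz)(g + p³z)` of surface type
`A₇⁽¹⁾'` follows. -/
theorem quantum_qPainleve_full_form {R : Type*} [Ring R] (p : Rˣ)
    (hp : ∀ x : R, (p : R) * x = x * (p : R))
    (g z k h : R)
    (hzg : z * g = g * z) (hzk : z * k = k * z)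
    (hkg : k * g = ((p⁻¹ : Rˣ) : R) ^ 2 * (g * k))
    (h₁ : IsUnit (g + (p : R))) (h₂ : IsUnit (g + (p : R) ^ 3))
    (hkh : k * h * (g + (p : R)) = g + (p : R) * z) :
    k ^ 2 * h ^ 2 * (g + (p : R)) * (g + (p : R) ^ 3)
      = (g + (p : R) * z) * (g + (p : R) ^ 3 * z) := by
  have hpc : ∀ x : R, Commute (p : R) x := hp
  have hkg' : (p : R) ^ 2 * (k * g) = g * k := by
    rw [hkg, ← mul_assoc, ← Units.val_pow_eq_pow_val, ← Units.val_pow_eq_pow_val, ← Units.val_mul,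
      inv_pow, mul_inv_cancel, Units.val_one, one_mul]
  have hkp : ∀ x : R, (p : R) ^ 2 * (k * (p * x)) = (p : R) ^ 3 * (k * x) := fun x => by
    rw [(hpc k).symm.left_comm, pow_succ (p : R) 2, mul_assoc]
  have hkA : (p : R) ^ 2 * (k * (g + p)) = (g + (p : R) ^ 3) * k := by
    have := hkp 1
    rw [mul_one, mul_one] at this
    rw [mul_add, mul_add, hkg', this, add_mul]
  have hkC : (p : R) ^ 2 * (k * (g + p * z)) = (g + (p : R) ^ 3 * z) * k := by
    rw [mul_add, mul_add, hkg', hkp, add_mul, mul_assoc _ z, hzk]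
  have hpg : Commute (p : R) g := hpc g
  have hgz : Commute g z := hzg.symm
  have hcomm : ∀ m n : ℕ, Commute (g + (p : R) ^ m) (g + (p : R) ^ n * z) := fun m n =>
    (((Commute.refl g).add_right ((hpg.symm.pow_right n).mul_right hgz)).add_left
      ((hpc _).pow_left m))
  have hAC : Commute (g + (p : R)) (g + p * z) := by simpa using hcomm 1 1
  have hBC : Commute (g + (p : R) ^ 3) (g + p * z) := by simpa using hcomm 3 1
  have hBD : Commute (g + (p : R) ^ 3) (g + (p : R) ^ 3 * z) := hcomm 3 3
  have hCD : Commute (g + (p : R) * z) (g + (p : R) ^ 3 * z) := by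
    have hz : Commute z (g + (p : R) ^ 3 * z) :=
      hgz.symm.add_right (((hpc z).symm.pow_right 3).mul_right (Commute.refl z))
    have hg : Commute g (g + (p : R) ^ 3 * z) :=
      (Commute.refl g).add_right ((hpg.symm.pow_right 3).mul_right hgz)
    exact hg.add_left ((hpc _).mul_left hz)
  generalize g + (p : R) = A at *
  generalize g + (p : R) ^ 3 = B at *
  generalize g + (p : R) * z = C at *
  generalize g + (p : R) ^ 3 * z = D at *
  have hFA : A * (k * h) = k * h * A := by
    apply h₁.mul_right_cancel
    rw [mul_assoc A, hkh, hAC.eq]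
  have hBkF : B * k * (k * h) = D * k := by
    rw [← hkA, mul_assoc, mul_assoc, hFA, hkh, hkC]
  have hBX : B * (k ^ 2 * h ^ 2 * A) = D * C :=
    calc B * (k ^ 2 * h ^ 2 * A) = B * k * (k * h) * h * A := by noncomm_ring
      _ = D * (k * h * A) := by rw [hBkF]; noncomm_ring
      _ = D * C := by rw [hkh]
  apply h₂.mul_left_cancel
  rw [← mul_assoc, hBX, hCD.eq, (hBD.mul_right hBC).eq]
end
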